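/- There exists a universal constant C > 0 with the following property. Suppose μ_o ∈ ℝᵖ, μ_o ≥ 0 coordinatewise, μ_o ≠ 0, satisfies R(μ_o) ≤ ε_o. Let 0 < ε₁ < 3/4, δ ∈ (0, 1/e], set λ = 2ε₁/(3‖μ_o‖₂²), and let n ≥ C · ‖μ_o‖₂² ‖κ‖₂² log(1/δ) / ε₁³ be even. Then, with probability at least 1 − 2δ over an i.i.d. sample S ~ Dⁿ, any minimizer μ̂ of (λ/2)‖μ‖₂² + R̂_S(μ) over {μ ≥ 0} satisfies R(μ̂) ≤ ε_o + ε₁; that is, μ̂ is (ε_o + ε₁)-combination good. -/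

import Mathlib

open MeasureTheory Finset

noncomputable section

/-- The ±1 real value of a Boolean label: `true ↦ 1`, `false ↦ -1`.
We encode the label space {−1, 1} by `Bool`. -/
def sgn (b : Bool) : ℝ := if b then 1 else -1

/-- The Euclidean (L2) norm on ℝᵖ. -/
def l2norm {p : ℕ} (μ : Fin p → ℝ) : ℝ := Real.sqrt (∑ i, μ i ^ 2)

/-- The L1 norm on ℝᵖ. -/
def l1norm {p : ℕ} (μ : Fin p → ℝ) : ℝ := ∑ i, |μ i|

/-- The L∞ (supremum) norm on ℝᵖ. -/
def linfnorm {p : ℕ} (μ : Fin p → ℝ) : ℝ := ⨆ i, |μ i|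

/-- The standard inner product on ℝᵖ. -/
def ip {p : ℕ} (μ v : Fin p → ℝ) : ℝ := ∑ i, μ i * v i

/-- The K-space feature map `z(x,x') = (K₁(x,x'),…,K_p(x,x'))`. -/
def zmap {X : Type*} {p : ℕ} (K : Fin p → X → X → ℝ) (x x' : X) : Fin p → ℝ :=
  fun i => K i x x'

/-- The pairwise hinge loss `ℓ(μ, (x,y), (x',y')) = max(0, 1 − y y' ⟨μ, z(x,x')⟩)`. -/
def hinge {X : Type*} {p : ℕ} (K : Fin p → X → X → ℝ) (μ : Fin p → ℝ)
    (w w' : X × Bool) : ℝ :=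
  max 0 (1 - sgn w.2 * sgn w'.2 * ip μ (zmap K w.1 w'.1))

/-- The empirical risk `R̂_S(μ) = (2/(n(n−1))) Σ_{1≤i<j≤n} ℓ(μ, (xᵢ,yᵢ), (xⱼ,yⱼ))`. -/
def empRisk {X : Type*} {p n : ℕ} (K : Fin p → X → X → ℝ)
    (S : Fin n → X × Bool) (μ : Fin p → ℝ) : ℝ :=
  (2 / ((n : ℝ) * ((n : ℝ) - 1))) *
    ∑ i : Fin n, ∑ j : Fin n, if i < j then hinge K μ (S i) (S j) else 0

/-- The true risk `R(μ) = E_{((x,y),(x',y')) ~ D×D}[max(0, 1 − y y' ⟨μ, z(x,x')⟩)]`. -/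
def trueRisk {X : Type*} [MeasurableSpace X] {p : ℕ} (K : Fin p → X → X → ℝ)
    (D : Measure (X × Bool)) (μ : Fin p → ℝ) : ℝ :=
  ∫ w, hinge K μ w.1 w.2 ∂(D.prod D)

/-- Expectation over m i.i.d. Rademacher random variables (uniform on {−1,+1}),
encoded by Booleans mapped to ±1 via `sgn`. -/
def radE {m : ℕ} (f : (Fin m → Bool) → ℝ) : ℝ :=
  (∑ ε : Fin m → Bool, f ε) / 2 ^ m

lemma ConvexOn.add_le_add_of_add_eq {s : Set ℝ} {f : ℝ → ℝ} (hf : ConvexOn ℝ s f) {a b P Q : ℝ}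
    (hP : P ∈ s) (hQ : Q ∈ s) (hsum : a + b = P + Q) (ha : a ≤ max P Q) (hb : b ≤ max P Q) :
    f a + f b ≤ f P + f Q := by
  wlog hPQ : Q ≤ P generalizing P Q
  · have := this hQ hP (by linarith) (by rwa [max_comm]) (by rwa [max_comm]) (by linarith)
    linarith
  rw [max_eq_left hPQ] at ha hb
  rcases hPQ.eq_or_lt with rfl | h
  · have h1 : a = Q := by linarith
    have h2 : b = Q := by linarith
    rw [h1, h2]
  have hd : 0 < P - Q := by linarith
  set θ := (a - Q) / (P - Q) with hθ
  have h0 : 0 ≤ θ := div_nonneg (by linarith) hd.le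
  have h1 : 0 ≤ 1 - θ := by
    have : θ ≤ 1 := by rw [hθ, div_le_one hd]; linarith
    linarith
  have hmul : θ * (P - Q) = a - Q := div_mul_cancel₀ _ hd.ne'
  have e1 := hf.2 hP hQ h0 h1 (by ring)
  have e2 := hf.2 hP hQ h1 h0 (by ring)
  simp only [smul_eq_mul] at e1 e2
  rw [show θ * P + (1 - θ) * Q = a by linear_combination hmul] at e1
  rw [show (1 - θ) * P + θ * Q = b by linear_combination -hmul - hsum] at e2
  linarith

lemma exp_add_exp_le_of_add_le {a b P Q : ℝ} (hsum : a + b ≤ P + Q)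
    (ha : a ≤ max P Q) (hb : b ≤ max P Q) :
    Real.exp a + Real.exp b ≤ Real.exp P + Real.exp Q := by
  by_cases h : P + Q - a ≤ max P Q
  · have := convexOn_exp.add_le_add_of_add_eq (a := a) (b := P + Q - a) (Set.mem_univ P)
      (Set.mem_univ Q) (by ring) ha h
    have : Real.exp b ≤ Real.exp (P + Q - a) := Real.exp_le_exp.2 (by linarith)
    linarith
  · have hmm := min_add_max P Q
    have h1 : Real.exp a ≤ Real.exp (min P Q) := Real.exp_le_exp.2 (by linarith)
    have h2 : Real.exp b ≤ Real.exp (max P Q) := Real.exp_le_exp.2 hb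
    rcases le_total P Q with h | h
    · rw [min_eq_left h] at h1; rw [max_eq_right h] at h2; linarith
    · rw [min_eq_right h] at h1; rw [max_eq_left h] at h2; linarith

lemma sum_fin_succ_bool {m : ℕ} (g : (Fin (m + 1) → Bool) → ℝ) :
    ∑ ε, g ε = ∑ b : Bool, ∑ ε : Fin m → Bool, g (Fin.cons b ε) := by
  rw [← (Fin.consEquiv fun _ : Fin (m + 1) => Bool).sum_comp, Fintype.sum_prod_type]
  rfl

lemma exp_sup'_contraction_step {ι : Type*} [Fintype ι] [Nonempty ι] (h a u : ι → ℝ)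
    (hlip : ∀ i j, |a i - a j| ≤ |u i - u j|) (habs : ∀ i, |a i| ≤ |u i|) :
    ∑ b : Bool, Real.exp (univ.sup' univ_nonempty fun i => h i + sgn b * a i) ≤
      ∑ b : Bool, Real.exp (univ.sup' univ_nonempty fun i => h i + sgn b * u i) := by
  simp only [Fintype.sum_bool, sgn, if_true, Bool.false_eq_true, if_false]
  obtain ⟨i, -, hi⟩ := exists_mem_eq_sup' univ_nonempty fun i => h i + 1 * a i
  obtain ⟨j, -, hj⟩ := exists_mem_eq_sup' univ_nonempty fun i => h i + -1 * a i
  have hP : ∀ k, h k + 1 * u k ≤ univ.sup' univ_nonempty fun i => h i + 1 * u i :=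
    fun k => le_sup' (fun i => h i + 1 * u i) (mem_univ k)
  have hQ : ∀ k, h k + -1 * u k ≤ univ.sup' univ_nonempty fun i => h i + -1 * u i :=
    fun k => le_sup' (fun i => h i + -1 * u i) (mem_univ k)
  rw [hi, hj]
  have hmax : ∀ k, h k + |u k| ≤ max (univ.sup' univ_nonempty fun i => h i + 1 * u i)
      (univ.sup' univ_nonempty fun i => h i + -1 * u i) := by
    intro k
    rcases abs_cases (u k) with ⟨h1, -⟩ | ⟨h1, -⟩
    · exact le_max_of_le_left (by linarith [hP k])
    · exact le_max_of_le_right (by linarith [hQ k])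
  refine exp_add_exp_le_of_add_le ?_ ?_ ?_
  · have := (le_abs_self _).trans (hlip i j)
    rcases abs_cases (u i - u j) with ⟨h1, -⟩ | ⟨h1, -⟩
    · linarith [hP i, hQ j]
    · linarith [hP j, hQ i]
  · linarith [hmax i, (le_abs_self _).trans (habs i)]
  · linarith [hmax j, (neg_le_abs _).trans (habs j)]

lemma exp_sup'_contraction {ι : Type*} [Fintype ι] [Nonempty ι] {m : ℕ} (h : ι → ℝ)
    (a u : Fin m → ι → ℝ) (hlip : ∀ k i j, |a k i - a k j| ≤ |u k i - u k j|)
    (habs : ∀ k i, |a k i| ≤ |u k i|) :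
    ∑ ε : Fin m → Bool,
        Real.exp (univ.sup' univ_nonempty fun i => h i + ∑ k, sgn (ε k) * a k i) ≤
      ∑ ε : Fin m → Bool,
        Real.exp (univ.sup' univ_nonempty fun i => h i + ∑ k, sgn (ε k) * u k i) := by
  induction m generalizing h with
  | zero => simp
  | succ m ih =>
    simp only [sum_fin_succ_bool, Fin.sum_univ_succ, Fin.cons_zero, Fin.cons_succ]
    calc _ = ∑ ε : Fin m → Bool, ∑ b : Bool, Real.exp (univ.sup' univ_nonempty fun i =>
            (h i + ∑ k, sgn (ε k) * a k.succ i) + sgn b * a 0 i) := by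
          rw [sum_comm]
          refine sum_congr rfl fun ε _ => sum_congr rfl fun b _ => ?_
          congr 2; ext i; ring
      _ ≤ ∑ ε : Fin m → Bool, ∑ b : Bool, Real.exp (univ.sup' univ_nonempty fun i =>
            (h i + ∑ k, sgn (ε k) * a k.succ i) + sgn b * u 0 i) :=
          sum_le_sum fun ε _ => exp_sup'_contraction_step _ _ _ (hlip 0) (habs 0)
      _ = ∑ b : Bool, ∑ ε : Fin m → Bool, Real.exp (univ.sup' univ_nonempty fun i =>
            (h i + sgn b * u 0 i) + ∑ k, sgn (ε k) * a k.succ i) := by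
          rw [sum_comm]
          refine sum_congr rfl fun b _ => sum_congr rfl fun ε _ => ?_
          congr 2; ext i; ring
      _ ≤ ∑ b : Bool, ∑ ε : Fin m → Bool, Real.exp (univ.sup' univ_nonempty fun i =>
            (h i + sgn b * u 0 i) + ∑ k, sgn (ε k) * u k.succ i) :=
          sum_le_sum fun b _ => ih _ _ _ (fun k => hlip k.succ) (fun k => habs k.succ)
      _ = _ := by simp only [add_assoc]

section InnerProduct
variable {E : Type*} [NormedAddCommGroup E] [InnerProductSpace ℝ E]

lemma cosh_add_cosh_le_of_sq_add_sq_eq {a b P Q : ℝ}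
    (hsum : a ^ 2 + b ^ 2 = P ^ 2 + Q ^ 2) (ha : a ^ 2 ≤ max (P ^ 2) (Q ^ 2))
    (hb : b ^ 2 ≤ max (P ^ 2) (Q ^ 2)) :
    Real.cosh a + Real.cosh b ≤ Real.cosh P + Real.cosh Q := by
  refine hasSum_le (fun k => ?_) ((Real.hasSum_cosh a).add (Real.hasSum_cosh b))
    ((Real.hasSum_cosh P).add (Real.hasSum_cosh Q))
  simp only [pow_mul, ← add_div]
  refine div_le_div_of_nonneg_right ?_ (by positivity)
  exact (convexOn_pow k).add_le_add_of_add_eq (sq_nonneg P) (sq_nonneg Q) hsum ha hb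

lemma cosh_norm_add_add_cosh_norm_sub_le (s : ℝ) (x y : E) :
    Real.cosh (s * ‖x + y‖) + Real.cosh (s * ‖x - y‖) ≤
      2 * (Real.cosh (s * ‖x‖) * Real.cosh (s * ‖y‖)) := by
  have h1 := Real.cosh_add (s * ‖x‖) (s * ‖y‖)
  have h2 := Real.cosh_sub (s * ‖x‖) (s * ‖y‖)
  have hle : ∀ z : E, ‖z‖ ≤ ‖x‖ + ‖y‖ → (s * ‖z‖) ^ 2 ≤
      max ((s * ‖x‖ + s * ‖y‖) ^ 2) ((s * ‖x‖ - s * ‖y‖) ^ 2) := by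
    intro z hz
    refine le_max_of_le_left ?_
    rw [← mul_add, mul_pow, mul_pow]
    gcongr
  have := cosh_add_cosh_le_of_sq_add_sq_eq (a := s * ‖x + y‖) (b := s * ‖x - y‖)
    (P := s * ‖x‖ + s * ‖y‖) (Q := s * ‖x‖ - s * ‖y‖)
    (by linear_combination s ^ 2 * parallelogram_law_with_norm ℝ x y)
    (hle _ (norm_add_le x y)) (hle _ (norm_sub_le x y))
  linarith

lemma sum_cosh_norm_add_sum_le {m : ℕ} (s : ℝ) {B : ℝ} (x : E) (v : Fin m → E)
    (hv : ∀ k, ‖v k‖ ≤ B) :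
    ∑ ε : Fin m → Bool, Real.cosh (s * ‖x + ∑ k, sgn (ε k) • v k‖) ≤
      2 ^ m * (Real.cosh (s * ‖x‖) * Real.cosh (s * B) ^ m) := by
  induction m generalizing x with
  | zero => simp
  | succ m ih =>
    simp only [sum_fin_succ_bool, Fin.sum_univ_succ, Fin.cons_zero, Fin.cons_succ, ← add_assoc]
    have hB : Real.cosh (s * ‖v 0‖) ≤ Real.cosh (s * B) := by
      rw [Real.cosh_le_cosh, abs_mul, abs_mul, abs_norm]
      gcongr
      exact (hv 0).trans (le_abs_self B)
    have hstep := cosh_norm_add_add_cosh_norm_sub_le s x (v 0)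
    calc _ ≤ ∑ b : Bool, 2 ^ m * (Real.cosh (s * ‖x + sgn b • v 0‖) * Real.cosh (s * B) ^ m) :=
          sum_le_sum fun b _ => ih _ _ fun k => hv k.succ
      _ = 2 ^ m * Real.cosh (s * B) ^ m *
            (Real.cosh (s * ‖x + v 0‖) + Real.cosh (s * ‖x - v 0‖)) := by
          simp only [Fintype.sum_bool, sgn, if_true, Bool.false_eq_true, if_false, one_smul,
            neg_smul, ← sub_eq_add_neg]
          ring
      _ ≤ 2 ^ m * Real.cosh (s * B) ^ m *
            (2 * (Real.cosh (s * ‖x‖) * Real.cosh (s * B))) := by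
          have := Real.cosh_pos (s * B)
          have := Real.cosh_pos (s * ‖x‖)
          refine mul_le_mul_of_nonneg_left (hstep.trans ?_) (by positivity)
          gcongr
      _ = _ := by ring

/-- Exponential-moment bound for the Rademacher complexity of a Lipschitz image of a family of
linear functionals in a ball of an inner product space. -/
lemma sum_exp_sup'_rademacher_le {ι : Type*} [Fintype ι] [Nonempty ι] {m : ℕ} {s r B : ℝ}
    (hs : 0 ≤ s) (φ : ℝ → ℝ) (hφ : ∀ a b, |φ a - φ b| ≤ |a - b|) (hφ0 : φ 0 = 0)
    (μ : ι → E) (hμ : ∀ i, ‖μ i‖ ≤ r) (v : Fin m → E) (hv : ∀ k, ‖v k‖ ≤ B) :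
    ∑ ε : Fin m → Bool, Real.exp (univ.sup' univ_nonempty fun i =>
        ∑ k, sgn (ε k) * (s * φ (inner ℝ (μ i) (v k)))) ≤
      2 ^ m * (2 * Real.exp (m * (s * r * B) ^ 2 / 2)) := by
  have hr : 0 ≤ r := (norm_nonneg _).trans (hμ (Classical.arbitrary ι))
  have hc := exp_sup'_contraction (fun _ : ι => 0)
    (fun k i => s * φ (inner ℝ (μ i) (v k))) (fun (k : Fin m) i => s * inner ℝ (μ i) (v k))
    (fun k i j => by
      rw [← mul_sub, ← mul_sub, abs_mul, abs_mul]
      exact mul_le_mul_of_nonneg_left (hφ _ _) (abs_nonneg s))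
    (fun k i => by
      rw [abs_mul, abs_mul]
      refine mul_le_mul_of_nonneg_left ?_ (abs_nonneg s)
      simpa [hφ0] using hφ (inner ℝ (μ i) (v k)) 0)
  simp only [zero_add] at hc
  refine hc.trans ?_
  calc _ ≤ ∑ ε : Fin m → Bool, 2 * Real.cosh ((s * r) * ‖(0 : E) + ∑ k, sgn (ε k) • v k‖) := by
        refine sum_le_sum fun ε _ => ?_
        have : (univ.sup' univ_nonempty fun i => ∑ k, sgn (ε k) * (s * inner ℝ (μ i) (v k))) ≤
            (s * r) * ‖(0 : E) + ∑ k, sgn (ε k) • v k‖ := by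
          refine sup'_le _ _ fun i _ => ?_
          have : ∑ k, sgn (ε k) * (s * inner ℝ (μ i) (v k)) =
              s * inner ℝ (μ i) (∑ k, sgn (ε k) • v k) := by
            rw [inner_sum, mul_sum]
            refine sum_congr rfl fun k _ => ?_
            rw [real_inner_smul_right]; ring
          rw [this, zero_add, mul_assoc]
          gcongr
          exact (real_inner_le_norm _ _).trans (by gcongr; exact hμ i)
        refine (Real.exp_le_exp.2 this).trans ?_
        rw [Real.cosh_eq]
        linarith [Real.exp_pos (-((s * r) * ‖(0 : E) + ∑ k, sgn (ε k) • v k‖))]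
    _ ≤ 2 * (2 ^ m * (Real.cosh (s * r * ‖(0 : E)‖) * Real.cosh (s * r * B) ^ m)) := by
        rw [← mul_sum]
        gcongr
        exact sum_cosh_norm_add_sum_le _ _ _ hv
    _ ≤ 2 * (2 ^ m * (1 * Real.exp ((s * r * B) ^ 2 / 2) ^ m)) := by
        simp only [norm_zero, mul_zero, Real.cosh_zero]
        have := Real.cosh_pos (s * r * B)
        gcongr
        exact Real.cosh_le_exp_half_sq _
    _ = _ := by
        rw [← Real.exp_nat_mul]; ring_nf

end InnerProduct

lemma sgn_not (b : Bool) : sgn (!b) = -sgn b := by cases b <;> simp [sgn]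

lemma MeasureTheory.MeasurePreserving.integral_comp_of_measurable {α β : Type*}
    [MeasurableSpace α] [MeasurableSpace β] {μ : Measure α} {ν : Measure β} {T : α → β}
    (hT : MeasurePreserving T μ ν) {g : β → ℝ} (hg : Measurable g) :
    ∫ x, g (T x) ∂μ = ∫ y, g y ∂ν := by
  rw [← hT.map_eq, integral_map hT.measurable.aemeasurable hg.aestronglyMeasurable]

section Symmetrization
variable {W ι : Type*} [Fintype ι] [Nonempty ι]

lemma exp_sup'_add_le (a b : ι → ℝ) :
    Real.exp (univ.sup' univ_nonempty fun i => a i + b i) ≤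
      (Real.exp (univ.sup' univ_nonempty fun i => 2 * a i) +
        Real.exp (univ.sup' univ_nonempty fun i => 2 * b i)) / 2 := by
  set A := univ.sup' univ_nonempty fun i => 2 * a i
  set B := univ.sup' univ_nonempty fun i => 2 * b i
  have h : (univ.sup' univ_nonempty fun i => a i + b i) ≤ (A + B) / 2 :=
    sup'_le _ _ fun i _ => by
      have h1 : 2 * a i ≤ A := le_sup' (fun i => 2 * a i) (mem_univ i)
      have h2 : 2 * b i ≤ B := le_sup' (fun i => 2 * b i) (mem_univ i)
      linarith
  refine (Real.exp_le_exp.2 h).trans ?_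
  have := convexOn_exp.2 (Set.mem_univ A) (Set.mem_univ B)
    (by norm_num : (0 : ℝ) ≤ 1 / 2) (by norm_num : (0 : ℝ) ≤ 1 / 2) (by norm_num)
  simp only [smul_eq_mul] at this
  rw [show (A + B) / 2 = 1 / 2 * A + 1 / 2 * B by ring]
  linarith

lemma sum_exp_sup'_sub_le {m : ℕ} {H : ℝ} (f : ι → W → ℝ)
    (hH : ∀ w : Fin m → W, ∑ ε : Fin m → Bool, Real.exp (univ.sup' univ_nonempty fun i =>
      ∑ k, sgn (ε k) * (2 * f i (w k))) ≤ 2 ^ m * H) (w w' : Fin m → W) :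
    ∑ ε : Fin m → Bool, Real.exp (univ.sup' univ_nonempty fun i =>
      ∑ k, sgn (ε k) * (f i (w' k) - f i (w k))) ≤ 2 ^ m * H := by
  have hneg : ∑ ε : Fin m → Bool, Real.exp (univ.sup' univ_nonempty fun i =>
      ∑ k, -(sgn (ε k) * (2 * f i (w k)))) ≤ 2 ^ m * H := by
    refine le_trans (le_of_eq ?_) (hH w)
    refine Fintype.sum_equiv (Equiv.arrowCongr (Equiv.refl _) Equiv.boolNot) _ _ fun ε => ?_
    simp [sgn_not]
  have h := hH w'
  calc _ ≤ ∑ ε : Fin m → Bool, (Real.exp (univ.sup' univ_nonempty fun i =>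
            ∑ k, sgn (ε k) * (2 * f i (w' k))) + Real.exp (univ.sup' univ_nonempty fun i =>
            ∑ k, -(sgn (ε k) * (2 * f i (w k))))) / 2 := by
        refine sum_le_sum fun ε _ => ?_
        have := exp_sup'_add_le (fun i => ∑ k, sgn (ε k) * f i (w' k))
          (fun i => ∑ k, -(sgn (ε k) * f i (w k)))
        simp only [← sum_add_distrib, mul_sum, mul_neg, ← sub_eq_add_neg, ← mul_sub,
          mul_left_comm (2 : ℝ)] at this
        exact this
    _ ≤ _ := by
        rw [← sum_div, sum_add_distrib]
        linarith

lemma measurable_exp_sup' {Ω : Type*} [MeasurableSpace Ω] {g : ι → Ω → ℝ}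
    (hg : ∀ i, Measurable (g i)) :
    Measurable fun ω => Real.exp (univ.sup' univ_nonempty fun i => g i ω) := by
  refine Real.measurable_exp.comp ?_
  have := Finset.measurable_sup' (univ_nonempty (α := ι)) (fun i _ => hg i)
  convert this using 1
  ext ω
  simp [Finset.sup'_apply]

lemma integrable_exp_sup' {Ω : Type*} [MeasurableSpace Ω] {P : Measure Ω} [IsFiniteMeasure P]
    {g : ι → Ω → ℝ} (hg : ∀ i, Measurable (g i)) {c : ℝ} (hc : ∀ i ω, g i ω ≤ c) :
    Integrable (fun ω => Real.exp (univ.sup' univ_nonempty fun i => g i ω)) P := by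
  refine Integrable.of_bound (measurable_exp_sup' hg).aestronglyMeasurable (Real.exp c)
    (ae_of_all _ fun ω => ?_)
  rw [Real.norm_eq_abs, Real.abs_exp]
  exact Real.exp_le_exp.2 (sup'_le _ _ fun i _ => hc i ω)

lemma exp_sup'_integral_le {Ω : Type*} [MeasurableSpace Ω] {P : Measure Ω}
    [IsProbabilityMeasure P] {g : ι → Ω → ℝ} (hg : ∀ i, Measurable (g i)) {c : ℝ}
    (hc : ∀ i ω, |g i ω| ≤ c) :
    Real.exp (univ.sup' univ_nonempty fun i => ∫ ω, g i ω ∂P) ≤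
      ∫ ω, Real.exp (univ.sup' univ_nonempty fun i => g i ω) ∂P := by
  obtain ⟨i, -, hi⟩ := exists_mem_eq_sup' univ_nonempty fun i => ∫ ω, g i ω ∂P
  have hint : Integrable (fun ω => Real.exp (g i ω)) P := by
    refine Integrable.of_bound (Real.measurable_exp.comp (hg i)).aestronglyMeasurable
      (Real.exp c) (ae_of_all _ fun ω => ?_)
    rw [Real.norm_eq_abs, Real.abs_exp]
    exact Real.exp_le_exp.2 ((le_abs_self _).trans (hc i ω))
  rw [hi]
  calc _ ≤ ∫ ω, Real.exp (g i ω) ∂P :=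
        convexOn_exp.map_integral_le Real.continuous_exp.continuousOn isClosed_univ
          (ae_of_all _ fun _ => Set.mem_univ _)
          (Integrable.of_bound (hg i).aestronglyMeasurable c (ae_of_all _ (hc i))) hint
    _ ≤ _ := integral_mono hint
        (integrable_exp_sup' hg fun i ω => (le_abs_self _).trans (hc i ω)) fun ω =>
          Real.exp_le_exp.2 (le_sup' (fun i => g i ω) (mem_univ i))

/-- Symmetrization for exponential moments of the supremum of an empirical process. -/
lemma integral_exp_sup'_le_of_rademacher [MeasurableSpace W] {m : ℕ} {H c : ℝ} (Q : Measure W)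
    [IsProbabilityMeasure Q] (f : ι → W → ℝ) (hf : ∀ i, Measurable (f i))
    (hc : ∀ i w, |f i w| ≤ c)
    (hH : ∀ w : Fin m → W, ∑ ε : Fin m → Bool, Real.exp (univ.sup' univ_nonempty fun i =>
      ∑ k, sgn (ε k) * (2 * f i (w k))) ≤ 2 ^ m * H) :
    ∫ w, Real.exp (univ.sup' univ_nonempty fun i => ∑ k : Fin m, (∫ x, f i x ∂Q - f i (w k)))
      ∂(Measure.pi fun _ => Q) ≤ H := by
  set P := Measure.pi fun _ : Fin m => Q with hP
  have hsub : ∀ i x y, |f i x - f i y| ≤ 2 * c := fun i x y =>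
    (abs_sub _ _).trans (by linarith [hc i x, hc i y])
  have hsum : ∀ i (w w' : Fin m → W), |∑ k, (f i (w' k) - f i (w k))| ≤ m * (2 * c) :=
    fun i w w' => (abs_sum_le_sum_abs _ _).trans <| by
      simpa using sum_le_sum fun k (_ : k ∈ (univ : Finset (Fin m))) => hsub i (w' k) (w k)
  have hmeas : ∀ i, Measurable fun q : (Fin m → W) × (Fin m → W) =>
      ∑ k, (f i (q.2 k) - f i (q.1 k)) := fun i => by
    refine Finset.measurable_fun_sum _ fun k _ => ?_
    exact ((hf i).comp ((measurable_pi_apply k).comp measurable_snd)).sub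
      ((hf i).comp ((measurable_pi_apply k).comp measurable_fst))
  have hstep : ∀ w : Fin m → W,
      Real.exp (univ.sup' univ_nonempty fun i => ∑ k : Fin m, (∫ x, f i x ∂Q - f i (w k))) ≤
      ∫ w', Real.exp (univ.sup' univ_nonempty fun i => ∑ k, (f i (w' k) - f i (w k))) ∂P := by
    intro w
    refine le_trans (le_of_eq ?_) (exp_sup'_integral_le (P := P)
      (fun i => (hmeas i).comp (measurable_prodMk_left (x := w))) (hsum · w))
    congr 2
    ext i
    have hint : ∀ k, Integrable (fun w' : Fin m → W => f i (w' k)) P := fun k =>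
      Integrable.of_bound ((hf i).comp (measurable_pi_apply k)).aestronglyMeasurable c
        (ae_of_all _ fun w' => hc i _)
    rw [integral_finsetSum (f := fun k (w' : Fin m → W) => f i (w' k) - f i (w k)) univ
      fun k _ => (hint k).sub (integrable_const _)]
    refine sum_congr rfl fun k _ => ?_
    rw [integral_sub (hint k) (integrable_const _),
      integral_comp_eval (μ := fun _ : Fin m => Q) (hf i).aestronglyMeasurable]
    simp
  have hG := measurable_exp_sup' hmeas
  have hGint := integrable_exp_sup' (P := P.prod P) hmeas
    (fun i q => (le_abs_self _).trans (hsum i q.1 q.2))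
  have hswap : ∀ ε : Fin m → Bool, ∫ q, Real.exp (univ.sup' univ_nonempty fun i =>
        ∑ k, (f i (q.2 k) - f i (q.1 k))) ∂(P.prod P) =
      ∫ ω : Fin m → W × W, Real.exp (univ.sup' univ_nonempty fun i =>
        ∑ k, sgn (ε k) * (f i (ω k).2 - f i (ω k).1)) ∂(Measure.pi fun _ => Q.prod Q) := by
    intro ε
    have h1 : MeasurePreserving (fun (ω : Fin m → W × W) k => if ε k then ω k else (ω k).swap)
        (Measure.pi fun _ => Q.prod Q) (Measure.pi fun _ => Q.prod Q) := by
      refine measurePreserving_pi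
        (f := fun k (x : W × W) => if ε k then x else x.swap) (fun _ => Q.prod Q)
        (fun _ => Q.prod Q) fun k => ?_
      cases ε k
      · simpa using Measure.measurePreserving_swap (μ := Q) (ν := Q)
      · exact MeasurePreserving.id (Q.prod Q)
    have h2 := (measurePreserving_arrowProdEquivProdArrow W W (Fin m) (fun _ => Q)
      (fun _ => Q)).comp h1
    rw [← h2.integral_comp_of_measurable hG]
    congr 1
    ext ω
    congr 2
    ext i
    refine sum_congr rfl fun k _ => ?_
    cases h : ε k <;> simp [MeasurableEquiv.arrowProdEquivProdArrow,
      Equiv.arrowProdEquivProdArrow, h, sgn]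
  have hmε : ∀ (ε : Fin m → Bool) i, Measurable fun ω : Fin m → W × W =>
      ∑ k, sgn (ε k) * (f i (ω k).2 - f i (ω k).1) := fun ε i => by
    refine Finset.measurable_fun_sum _ fun k _ => Measurable.const_mul ?_ _
    exact ((hf i).comp (measurable_snd.comp (measurable_pi_apply k))).sub
      ((hf i).comp (measurable_fst.comp (measurable_pi_apply k)))
  have hintε : ∀ ε : Fin m → Bool, Integrable (fun ω : Fin m → W × W =>
      Real.exp (univ.sup' univ_nonempty fun i =>
        ∑ k, sgn (ε k) * (f i (ω k).2 - f i (ω k).1))) (Measure.pi fun _ => Q.prod Q) :=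
    fun ε => integrable_exp_sup' (hmε ε) (c := m * (2 * c)) fun i ω => by
      refine (sum_le_sum (g := fun _ => 2 * c) fun k _ => ?_).trans (by simp)
      refine (le_abs_self _).trans ?_
      rw [abs_mul, show |sgn (ε k)| = 1 by cases ε k <;> simp [sgn], one_mul]
      exact hsub i _ _
  calc _ ≤ ∫ w, ∫ w', Real.exp (univ.sup' univ_nonempty fun i =>
          ∑ k, (f i (w' k) - f i (w k))) ∂P ∂P := by
        refine integral_mono_of_nonneg (ae_of_all _ fun _ => (Real.exp_pos _).le)
          hGint.integral_prod_left (ae_of_all _ hstep)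
    _ = ∫ q, Real.exp (univ.sup' univ_nonempty fun i =>
        ∑ k, (f i (q.2 k) - f i (q.1 k))) ∂(P.prod P) := (integral_prod _ hGint).symm
    _ ≤ H := by
        set I := ∫ q, Real.exp (univ.sup' univ_nonempty fun i =>
          ∑ k, (f i (q.2 k) - f i (q.1 k))) ∂(P.prod P)
        have hsumI : (2 : ℝ) ^ m * I ≤ 2 ^ m * H := by
          calc (2 : ℝ) ^ m * I = ∑ ε : Fin m → Bool, I := by simp
            _ = ∫ ω, ∑ ε : Fin m → Bool, Real.exp (univ.sup' univ_nonempty fun i =>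
                ∑ k, sgn (ε k) * (f i (ω k).2 - f i (ω k).1))
                  ∂(Measure.pi fun _ => Q.prod Q) := by
                rw [integral_finsetSum _ fun ε _ => hintε ε]
                exact sum_congr rfl fun ε _ => hswap ε
            _ ≤ ∫ ω, 2 ^ m * H ∂(Measure.pi fun _ : Fin m => Q.prod Q) :=
                integral_mono (integrable_finsetSum _ fun ε _ => hintε ε)
                  (integrable_const _) fun ω =>
                    sum_exp_sup'_sub_le f hH (fun k => (ω k).1) fun k => (ω k).2
            _ = 2 ^ m * H := by simp
        exact le_of_mul_le_mul_left hsumI (by positivity)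

end Symmetrization

lemma exists_perm_map_pair {α : Type*} [DecidableEq α] {a b c d : α} (hab : a ≠ b) (hcd : c ≠ d) :
    ∃ τ : Equiv.Perm α, τ a = c ∧ τ b = d := by
  refine ⟨Equiv.swap (Equiv.swap a c b) d * Equiv.swap a c, ?_, ?_⟩
  · rw [Equiv.Perm.mul_apply, Equiv.swap_apply_left]
    refine Equiv.swap_apply_of_ne_of_ne (fun h => hab ?_) hcd
    exact (Equiv.swap a c).injective (by rw [← h, Equiv.swap_apply_left])
  · rw [Equiv.Perm.mul_apply, Equiv.swap_apply_left]

/-- Averaging over all permutations turns a single off-diagonal entry into the mean of all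
off-diagonal entries. -/
lemma mul_sum_perm_eq {α : Type*} [Fintype α] [DecidableEq α] (g : α → α → ℝ) {a b : α}
    (hab : a ≠ b) :
    (Fintype.card α : ℝ) * (Fintype.card α - 1) * ∑ σ : Equiv.Perm α, g (σ a) (σ b) =
      (Fintype.card α).factorial * ∑ i, ∑ j, if i ≠ j then g i j else 0 := by
  have hT : ∀ c d : α, c ≠ d → ∑ σ : Equiv.Perm α, g (σ c) (σ d) =
      ∑ σ : Equiv.Perm α, g (σ a) (σ b) := by
    intro c d hcd
    obtain ⟨τ, h1, h2⟩ := exists_perm_map_pair hab hcd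
    exact Fintype.sum_equiv (Equiv.mulRight τ) _ _ fun σ => by simp [h1, h2]
  have h1 : ∀ σ : Equiv.Perm α, (∑ i, ∑ j, if i ≠ j then g (σ i) (σ j) else 0) =
      ∑ i, ∑ j, if i ≠ j then g i j else 0 := by
    intro σ
    refine Fintype.sum_equiv σ _ _ fun i => Fintype.sum_equiv σ _ _ fun j => ?_
    simp
  calc _ = ∑ i : α, ∑ j : α, if i ≠ j then ∑ σ : Equiv.Perm α, g (σ i) (σ j) else 0 := by
        set T := ∑ σ : Equiv.Perm α, g (σ a) (σ b)
        have : ∀ i : α, (∑ j : α, if i ≠ j then ∑ σ : Equiv.Perm α, g (σ i) (σ j) else 0) =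
            (Fintype.card α - 1) * T := by
          intro i
          have h2 : ∀ j, (if i ≠ j then ∑ σ : Equiv.Perm α, g (σ i) (σ j) else 0) =
              T - if i = j then T else 0 := by
            intro j
            by_cases h : i = j
            · simp [h]
            · simp [h, hT i j h, T]
          simp only [h2, sum_sub_distrib, sum_ite_eq, mem_univ, if_true, sum_const, card_univ,
            nsmul_eq_mul]
          ring
        simp only [this, sum_const, card_univ, nsmul_eq_mul]
        ring
    _ = ∑ σ : Equiv.Perm α, ∑ i, ∑ j, if i ≠ j then g (σ i) (σ j) else 0 := by
        rw [sum_comm]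
        have : ∀ i j : α, (if i ≠ j then ∑ σ : Equiv.Perm α, g (σ i) (σ j) else 0) =
            ∑ σ : Equiv.Perm α, if i ≠ j then g (σ i) (σ j) else 0 := by
          intro i j; split_ifs <;> simp
        simp only [this]
        rw [sum_comm]
        simp only [sum_comm (s := (univ : Finset α)) (t := (univ : Finset (Equiv.Perm α)))]
    _ = _ := by simp only [h1, sum_const, card_univ, Fintype.card_perm, nsmul_eq_mul]

/-- The mean of `g` over the pairs `i < j`. -/
def pairMean {n : ℕ} (g : Fin n → Fin n → ℝ) : ℝ :=
  (2 / ((n : ℝ) * ((n : ℝ) - 1))) * ∑ i : Fin n, ∑ j : Fin n, if i < j then g i j else 0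

lemma sum_perm_eq_pairMean {n : ℕ} (hn : 2 ≤ n) (g : Fin n → Fin n → ℝ) {a b : Fin n}
    (hab : a ≠ b) :
    ∑ σ : Equiv.Perm (Fin n), (if σ a < σ b then g (σ a) (σ b) else g (σ b) (σ a)) =
      n.factorial * pairMean g := by
  have h := mul_sum_perm_eq (fun i j => if i < j then g i j else g j i) hab
  have hsplit : (∑ i : Fin n, ∑ j : Fin n, if i ≠ j then (if i < j then g i j else g j i) else 0) =
      2 * ∑ i : Fin n, ∑ j : Fin n, if i < j then g i j else 0 := by
    have : ∀ i j : Fin n, (if i ≠ j then (if i < j then g i j else g j i) else 0) =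
        (if i < j then g i j else 0) + if j < i then g j i else 0 := by
      intro i j
      rcases lt_trichotomy i j with h | rfl | h
      · simp [h, h.ne, h.not_gt]
      · simp
      · simp [h, h.ne', h.not_gt]
    simp only [this, sum_add_distrib]
    rw [sum_comm (f := fun i j : Fin n => if j < i then g j i else 0), two_mul]
  rw [hsplit] at h
  simp only [Fintype.card_fin] at h
  have hn' : (2 : ℝ) ≤ n := by exact_mod_cast hn
  have h0 : (n : ℝ) * (n - 1) ≠ 0 := by
    have : (0 : ℝ) < n * (n - 1) := mul_pos (by linarith) (by linarith)
    exact this.ne'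
  have h1 : (n : ℝ) - 1 ≠ 0 := right_ne_zero_of_mul h0
  have h2 : (n : ℝ) ≠ 0 := left_ne_zero_of_mul h0
  rw [pairMean, ← mul_right_inj' h0, h]
  field_simp

/-- The sample pairs matched by `e` after permuting by `σ`, each listed in increasing order of
index. -/
def matchedPairs {Z : Type*} {n m : ℕ} (e : Fin m ⊕ Fin m ≃ Fin n) (σ : Equiv.Perm (Fin n))
    (S : Fin n → Z) (k : Fin m) : Z × Z :=
  if σ (e (.inl k)) < σ (e (.inr k)) then (S (σ (e (.inl k))), S (σ (e (.inr k))))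
  else (S (σ (e (.inr k))), S (σ (e (.inl k))))

lemma measurePreserving_matchedPairs {Z : Type*} [MeasurableSpace Z] {n m : ℕ}
    (D : Measure Z) [IsProbabilityMeasure D]
    (e : Fin m ⊕ Fin m ≃ Fin n) (σ : Equiv.Perm (Fin n)) :
    MeasurePreserving (matchedPairs (Z := Z) e σ) (Measure.pi fun _ => D)
      (Measure.pi fun _ => D.prod D) := by
  have h1 := measurePreserving_arrowCongr' (fun _ : Fin n => D) (fun _ : Fin m ⊕ Fin m => D)
    (e.trans σ).symm (MeasurableEquiv.refl Z) fun _ => MeasurePreserving.id D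
  have h2 := measurePreserving_sumPiEquivProdPi (X := fun _ : Fin m ⊕ Fin m => Z) fun _ => D
  have h3 := (measurePreserving_arrowProdEquivProdArrow Z Z (Fin m) (fun _ => D)
    (fun _ => D)).symm
  have h4 := measurePreserving_pi
    (f := fun k (x : Z × Z) => if σ (e (.inl k)) < σ (e (.inr k)) then x else x.swap)
    (fun _ => D.prod D) (fun _ => D.prod D) fun k => by
      by_cases h : σ (e (.inl k)) < σ (e (.inr k))
      · simp only [h, if_true]
        exact MeasurePreserving.id (D.prod D)
      · simpa only [h, if_false] using Measure.measurePreserving_swap (μ := D) (ν := D)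
  have h5 := h4.comp (h3.comp (h2.comp h1))
  convert h5 using 1
  funext S k
  by_cases h : σ (e (.inl k)) < σ (e (.inr k))
  · simp only [matchedPairs, Function.comp_apply, h, if_true]
    rfl
  · simp only [matchedPairs, Function.comp_apply, h, if_false]
    rfl

section UStatistic
variable {Z ι : Type*} [MeasurableSpace Z] [Fintype ι] [Nonempty ι]

/-- Exponential moments of the supremum of a centred U-process are controlled by Rademacher
averages over half as many independent pairs. -/
lemma integral_exp_sup'_pairMean_le {n m : ℕ} (hn : 2 ≤ n) (e : Fin m ⊕ Fin m ≃ Fin n) {H c : ℝ}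
    (D : Measure Z) [IsProbabilityMeasure D] (f : ι → Z × Z → ℝ) (hf : ∀ i, Measurable (f i))
    (hc : ∀ i w, |f i w| ≤ c)
    (hH : ∀ w : Fin m → Z × Z, ∑ ε : Fin m → Bool, Real.exp (univ.sup' univ_nonempty fun i =>
      ∑ k, sgn (ε k) * (2 * f i (w k))) ≤ 2 ^ m * H) :
    ∫ S, Real.exp (univ.sup' univ_nonempty fun i =>
      m * (∫ x, f i x ∂(D.prod D) - pairMean fun a b => f i (S a, S b)))
        ∂(Measure.pi fun _ : Fin n => D) ≤ H := by
  set Y : Equiv.Perm (Fin n) → ι → (Fin n → Z) → ℝ := fun σ i S =>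
    ∑ k : Fin m, (∫ x, f i x ∂(D.prod D) - f i (matchedPairs e σ S k)) with hY
  have hfac : (0 : ℝ) < n.factorial := by exact_mod_cast n.factorial_pos
  have hdecomp : ∀ i (S : Fin n → Z),
      m * (∫ x, f i x ∂(D.prod D) - pairMean fun a b => f i (S a, S b)) =
        ∑ σ : Equiv.Perm (Fin n), (n.factorial : ℝ)⁻¹ * Y σ i S := by
    intro i S
    have hk : ∀ k : Fin m, ∑ σ : Equiv.Perm (Fin n), f i (matchedPairs e σ S k) =
        n.factorial * pairMean fun a b => f i (S a, S b) := by
      intro k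
      rw [← sum_perm_eq_pairMean hn (fun a b => f i (S a, S b))
        (show e (.inl k) ≠ e (.inr k) by simp)]
      refine sum_congr rfl fun σ _ => ?_
      simp only [matchedPairs]
      split_ifs <;> rfl
    rw [← mul_sum, hY]
    simp only
    rw [sum_comm]
    simp only [sum_sub_distrib, hk, sum_const, card_univ, Fintype.card_perm, Fintype.card_fin,
      nsmul_eq_mul]
    field_simp
  have hmY : ∀ i, Measurable fun w : Fin m → Z × Z =>
      ∑ k : Fin m, (∫ x, f i x ∂(D.prod D) - f i (w k)) := fun i =>
    Finset.measurable_fun_sum _ fun k _ =>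
      measurable_const.sub ((hf i).comp (measurable_pi_apply k))
  have hbY : ∀ i (w : Fin m → Z × Z),
      ∑ k : Fin m, (∫ x, f i x ∂(D.prod D) - f i (w k)) ≤ m * (c + c) := fun i w => by
    refine (sum_le_sum (g := fun _ => c + c) fun k _ => ?_).trans (by simp [mul_add])
    have h1 : ‖∫ x, f i x ∂(D.prod D)‖ ≤ c := by
      simpa using norm_integral_le_of_norm_le_const (μ := D.prod D) (f := f i) (C := c)
        (ae_of_all _ fun w => by simpa only [Real.norm_eq_abs] using hc i w)
    have := (le_abs_self _).trans h1
    have := (neg_le_abs _).trans (hc i (w k))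
    linarith
  have hint : ∀ σ, Integrable (fun S => Real.exp (univ.sup' univ_nonempty fun i => Y σ i S))
      (Measure.pi fun _ : Fin n => D) := fun σ =>
    integrable_exp_sup' (fun i => (hmY i).comp (measurePreserving_matchedPairs D e σ).measurable)
      fun i S => hbY i _
  have hle : ∀ σ, ∫ S, Real.exp (univ.sup' univ_nonempty fun i => Y σ i S)
      ∂(Measure.pi fun _ : Fin n => D) ≤ H := fun σ => by
    rw [(measurePreserving_matchedPairs D e σ).integral_comp_of_measurable
      (g := fun w => Real.exp (univ.sup' univ_nonempty fun i =>
        ∑ k : Fin m, (∫ x, f i x ∂(D.prod D) - f i (w k)))) (measurable_exp_sup' hmY)]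
    exact integral_exp_sup'_le_of_rademacher _ f hf hc hH
  have hpt : ∀ S : Fin n → Z, Real.exp (univ.sup' univ_nonempty fun i =>
      m * (∫ x, f i x ∂(D.prod D) - pairMean fun a b => f i (S a, S b))) ≤
      ∑ σ : Equiv.Perm (Fin n), (n.factorial : ℝ)⁻¹ *
        Real.exp (univ.sup' univ_nonempty fun i => Y σ i S) := by
    intro S
    obtain ⟨i, -, hi⟩ := exists_mem_eq_sup' univ_nonempty fun i =>
      m * (∫ x, f i x ∂(D.prod D) - pairMean fun a b => f i (S a, S b))
    rw [hi, hdecomp]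
    refine (convexOn_exp.map_sum_le (fun _ _ => by positivity) ?_
      fun _ _ => Set.mem_univ _).trans (sum_le_sum fun σ _ => ?_)
    · simp [Fintype.card_perm, hfac.ne']
    · rw [smul_eq_mul]
      gcongr
      exact le_sup' (fun i => Y σ i S) (mem_univ i)
  calc _ ≤ ∫ S, ∑ σ : Equiv.Perm (Fin n), (n.factorial : ℝ)⁻¹ *
        Real.exp (univ.sup' univ_nonempty fun i => Y σ i S) ∂(Measure.pi fun _ : Fin n => D) :=
      integral_mono_of_nonneg (ae_of_all _ fun _ => (Real.exp_pos _).le)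
        (integrable_finsetSum _ fun σ _ => (hint σ).const_mul _) (ae_of_all _ hpt)
    _ = ∑ σ : Equiv.Perm (Fin n), (n.factorial : ℝ)⁻¹ *
        ∫ S, Real.exp (univ.sup' univ_nonempty fun i => Y σ i S)
          ∂(Measure.pi fun _ : Fin n => D) := by
      rw [integral_finsetSum _ fun σ _ => (hint σ).const_mul _]
      simp only [integral_const_mul]
    _ ≤ ∑ σ : Equiv.Perm (Fin n), (n.factorial : ℝ)⁻¹ * H :=
      sum_le_sum fun σ _ => mul_le_mul_of_nonneg_left (hle σ) (by positivity)
    _ = H := by simp [Fintype.card_perm, hfac.ne']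

end UStatistic

section UniformDeviation
variable {Z E : Type*} [MeasurableSpace Z] [NormedAddCommGroup E] [InnerProductSpace ℝ E]

lemma pairMean_const_mul {n : ℕ} (s : ℝ) (g : Fin n → Fin n → ℝ) :
    pairMean (fun a b => s * g a b) = s * pairMean g := by
  simp only [pairMean, mul_left_comm s, mul_sum, mul_ite, mul_zero]

lemma pairMean_add {n : ℕ} (g h : Fin n → Fin n → ℝ) :
    pairMean (fun a b => g a b + h a b) = pairMean g + pairMean h := by
  have : ∀ a b : Fin n, (if a < b then g a b + h a b else 0) =
      (if a < b then g a b else 0) + if a < b then h a b else 0 := fun a b => by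
    split_ifs <;> simp
  simp only [pairMean, this, sum_add_distrib, mul_add]

lemma pairMean_const {n : ℕ} (hn : 2 ≤ n) (c : ℝ) :
    pairMean (fun _ _ : Fin n => c) = c := by
  have h := sum_perm_eq_pairMean hn (fun _ _ => c) (a := ⟨0, by omega⟩) (b := ⟨1, by omega⟩)
    (by simp)
  have hfac : (n.factorial : ℝ) ≠ 0 := by exact_mod_cast n.factorial_ne_zero
  simp only [ite_self, sum_const, card_univ, Fintype.card_perm, Fintype.card_fin,
    nsmul_eq_mul] at h
  exact (mul_left_cancel₀ hfac h).symm

lemma pairMean_mono {n : ℕ} (hn : 2 ≤ n) {g h : Fin n → Fin n → ℝ} (hgh : ∀ a b, g a b ≤ h a b) :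
    pairMean g ≤ pairMean h := by
  have hn' : (2 : ℝ) ≤ n := by exact_mod_cast hn
  have h0 : (0 : ℝ) < n * (n - 1) := mul_pos (by linarith) (by linarith)
  refine mul_le_mul_of_nonneg_left (sum_le_sum fun a _ => sum_le_sum fun b _ => ?_) (by positivity)
  split_ifs
  exacts [hgh a b, le_rfl]

lemma measurable_pairMean {n : ℕ} {f : Z × Z → ℝ} (hf : Measurable f) :
    Measurable fun S : Fin n → Z => pairMean fun a b => f (S a, S b) := by
  unfold pairMean
  refine Measurable.const_mul (Finset.measurable_fun_sum _ fun a _ =>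
    Finset.measurable_fun_sum _ fun b _ => ?_) _
  split_ifs
  · exact hf.comp ((measurable_pi_apply a).prodMk (measurable_pi_apply b))
  · exact measurable_const

lemma continuous_of_abs_sub_le {φ : ℝ → ℝ} (hφ : ∀ a b, |φ a - φ b| ≤ |a - b|) : Continuous φ :=
  (LipschitzWith.of_dist_le_mul (K := 1) fun a b => by
    simpa [Real.dist_eq] using hφ a b).continuous

lemma abs_comp_inner_le {φ : ℝ → ℝ} (hφ : ∀ a b, |φ a - φ b| ≤ |a - b|) (hφ0 : φ 0 = 0) {r B : ℝ}
    {μ v : E} (hμ : ‖μ‖ ≤ r) (hv : ‖v‖ ≤ B) : |φ (inner ℝ μ v)| ≤ r * B := by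
  have h := hφ (inner ℝ μ v) 0
  rw [hφ0, sub_zero, sub_zero] at h
  exact h.trans ((abs_real_inner_le_norm μ v).trans
    (mul_le_mul hμ hv (norm_nonneg _) ((norm_nonneg _).trans hμ)))

variable [MeasurableSpace E] [BorelSpace E] [SecondCountableTopology E]

lemma measure_exists_fin_pairMean_lt_le {ι : Type*} [Fintype ι] [Nonempty ι] {n m : ℕ} (hn : 2 ≤ n)
    (e : Fin m ⊕ Fin m ≃ Fin n) (D : Measure Z) [IsProbabilityMeasure D] {s r B η : ℝ}
    (hs : 0 ≤ s) {φ : ℝ → ℝ} (hφ : ∀ a b, |φ a - φ b| ≤ |a - b|) (hφ0 : φ 0 = 0)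
    {v : Z × Z → E} (hvm : Measurable v) (hv : ∀ x, ‖v x‖ ≤ B)
    (μ : ι → E) (hμ : ∀ i, ‖μ i‖ ≤ r) :
    (Measure.pi fun _ : Fin n => D) {S | ∃ i, η < ∫ x, φ (inner ℝ (μ i) (v x)) ∂(D.prod D) -
      pairMean fun a b => φ (inner ℝ (μ i) (v (S a, S b)))} ≤
      ENNReal.ofReal (2 * Real.exp (m * (2 * s * r * B) ^ 2 / 2 - m * s * η)) := by
  have hφc := continuous_of_abs_sub_le hφ
  have hm : ∀ i, Measurable fun x => φ (inner ℝ (μ i) (v x)) := fun i =>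
    hφc.measurable.comp (hvm.const_inner)
  have hfm : ∀ i, Measurable fun x => s * φ (inner ℝ (μ i) (v x)) := fun i => (hm i).const_mul s
  have hb : ∀ i x, |s * φ (inner ℝ (μ i) (v x))| ≤ s * (r * B) := fun i x => by
    rw [abs_mul, abs_of_nonneg hs]
    exact mul_le_mul_of_nonneg_left (abs_comp_inner_le hφ hφ0 (hμ i) (hv x)) hs
  have hexp := integral_exp_sup'_pairMean_le hn e (H := 2 * Real.exp (m * (2 * s * r * B) ^ 2 / 2))
    D (fun i x => s * φ (inner ℝ (μ i) (v x))) hfm hb fun w => by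
      have := sum_exp_sup'_rademacher_le (s := 2 * s) (by positivity) φ hφ hφ0 μ hμ
        (fun k => v (w k)) fun k => hv (w k)
      simpa only [mul_assoc] using this
  set F : ι → (Fin n → Z) → ℝ := fun i S => m * (∫ x, s * φ (inner ℝ (μ i) (v x)) ∂(D.prod D) -
    pairMean fun a b => s * φ (inner ℝ (μ i) (v (S a, S b)))) with hF
  have hFm : ∀ i, Measurable (F i) := fun i =>
    (measurable_const.sub (measurable_pairMean (hfm i))).const_mul _
  have hFs : ∀ i S, F i S = m * s * (∫ x, φ (inner ℝ (μ i) (v x)) ∂(D.prod D) -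
      pairMean fun a b => φ (inner ℝ (μ i) (v (S a, S b)))) := fun i S => by
    simp only [hF, integral_const_mul, pairMean_const_mul]
    ring
  have hint : Integrable (fun S => Real.exp (univ.sup' univ_nonempty fun i => F i S))
      (Measure.pi fun _ : Fin n => D) := by
    refine integrable_exp_sup' hFm (c := m * (s * (r * B) + s * (r * B))) fun i S =>
      mul_le_mul_of_nonneg_left ?_ m.cast_nonneg
    have h1 : ‖∫ x, s * φ (inner ℝ (μ i) (v x)) ∂(D.prod D)‖ ≤ s * (r * B) := by
      simpa using norm_integral_le_of_norm_le_const (μ := D.prod D) (C := s * (r * B))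
        (f := fun x => s * φ (inner ℝ (μ i) (v x)))
        (ae_of_all _ fun x => by simpa only [Real.norm_eq_abs] using hb i x)
    have h2 := (pairMean_const hn (-(s * (r * B)))).symm.trans_le
      (pairMean_mono hn fun a b => neg_le_of_abs_le (hb i (S a, S b)))
    have := (le_abs_self _).trans h1
    linarith
  have hmarkov := mul_meas_ge_le_integral_of_nonneg
    (ae_of_all _ fun S => (Real.exp_pos _).le) hint (Real.exp (m * s * η))
  have hmk : (Measure.pi fun _ : Fin n => D).real
      {S | Real.exp (m * s * η) ≤ Real.exp (univ.sup' univ_nonempty fun i => F i S)} ≤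
      2 * Real.exp (m * (2 * s * r * B) ^ 2 / 2 - m * s * η) := by
    rw [Real.exp_sub, mul_div_assoc', le_div_iff₀ (Real.exp_pos _), mul_comm]
    exact hmarkov.trans hexp
  refine (measure_mono ?_).trans ((ENNReal.le_ofReal_iff_toReal_le (measure_ne_top _ _)
    (by positivity)).2 hmk)
  rintro S ⟨i, hi⟩
  refine Real.exp_le_exp.2 (le_trans ?_ (le_sup' (fun i => F i S) (mem_univ i)))
  rw [hFs]
  gcongr

/-- Uniform one-sided deviation of a U-statistic of order two over a ball of linear functionals
composed with a `1`-Lipschitz function. -/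
lemma measure_exists_pairMean_lt_le {n m : ℕ} (hn : 2 ≤ n)
    (e : Fin m ⊕ Fin m ≃ Fin n) (D : Measure Z) [IsProbabilityMeasure D] {s r B η : ℝ}
    (hs : 0 ≤ s) (hr : 0 ≤ r) {φ : ℝ → ℝ} (hφ : ∀ a b, |φ a - φ b| ≤ |a - b|) (hφ0 : φ 0 = 0)
    {v : Z × Z → E} (hvm : Measurable v) (hv : ∀ x, ‖v x‖ ≤ B) :
    (Measure.pi fun _ : Fin n => D) {S | ∃ μ : E, ‖μ‖ ≤ r ∧
      η < ∫ x, φ (inner ℝ μ (v x)) ∂(D.prod D) -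
        pairMean fun a b => φ (inner ℝ μ (v (S a, S b)))} ≤
      ENNReal.ofReal (2 * Real.exp (m * (2 * s * r * B) ^ 2 / 2 - m * s * η)) := by
  have hφc := continuous_of_abs_sub_le hφ
  let T := {μ : E // ‖μ‖ ≤ r}
  have : Nonempty T := ⟨⟨0, by simpa using hr⟩⟩
  set G : (Fin n → Z) → T → ℝ := fun S μ => ∫ x, φ (inner ℝ μ.1 (v x)) ∂(D.prod D) -
    pairMean fun a b => φ (inner ℝ μ.1 (v (S a, S b))) with hG
  have hGc : ∀ S, Continuous (G S) := fun S => by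
    refine Continuous.sub ?_ ?_
    · refine continuous_of_dominated (bound := fun _ => r * B) (fun μ => ?_) (fun μ => ?_)
        (integrable_const _) (ae_of_all _ fun x => by fun_prop)
      · exact (hφc.measurable.comp hvm.const_inner).aestronglyMeasurable
      · exact ae_of_all _ fun x => abs_comp_inner_le hφ hφ0 μ.2 (hv x)
    · unfold pairMean
      refine continuous_const.mul (continuous_finsetSum _ fun a _ =>
        continuous_finsetSum _ fun b _ => ?_)
      split_ifs <;> fun_prop
  set u : ℕ → T := TopologicalSpace.denseSeq T
  have hmono : Monotone fun N : ℕ => {S | ∃ i : Fin (N + 1), η < G S (u i)} := by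
    rintro N M hNM S ⟨i, hi⟩
    exact ⟨Fin.castLE (by omega) i, hi⟩
  have hsub : {S : Fin n → Z | ∃ μ : E, ‖μ‖ ≤ r ∧ η < ∫ x, φ (inner ℝ μ (v x)) ∂(D.prod D) -
      pairMean fun a b => φ (inner ℝ μ (v (S a, S b)))} ⊆
      ⋃ N : ℕ, {S | ∃ i : Fin (N + 1), η < G S (u i)} := by
    rintro S ⟨μ, hμ, h⟩
    obtain ⟨y, hy, k, rfl⟩ := (TopologicalSpace.denseRange_denseSeq T).inter_open_nonempty
      {ν | η < G S ν} (isOpen_lt continuous_const (hGc S)) ⟨⟨μ, hμ⟩, h⟩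
    exact Set.mem_iUnion.2 ⟨k, Fin.last k, by simpa using hy⟩
  refine (measure_mono hsub).trans ?_
  rw [hmono.measure_iUnion]
  exact iSup_le fun N => measure_exists_fin_pairMean_lt_le hn e D hs hφ hφ0 hvm hv
    (fun i : Fin (N + 1) => (u i).1) fun i => (u i).2

end UniformDeviation

section Risk
variable {X : Type*} {p n : ℕ} (K : Fin p → X → X → ℝ)

lemma norm_toLp_eq_l2norm (μ : Fin p → ℝ) : ‖WithLp.toLp 2 μ‖ = l2norm μ := by
  simp [EuclideanSpace.norm_eq, l2norm]

/-- The label-signed feature map of a pair of examples. -/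
def signedFeature (w : (X × Bool) × (X × Bool)) : EuclideanSpace ℝ (Fin p) :=
  WithLp.toLp 2 fun i => sgn w.1.2 * sgn w.2.2 * K i w.1.1 w.2.1

lemma inner_signedFeature (μ : Fin p → ℝ) (w : (X × Bool) × (X × Bool)) :
    inner ℝ (WithLp.toLp 2 μ) (signedFeature K w) =
      sgn w.1.2 * sgn w.2.2 * ip μ (zmap K w.1.1 w.2.1) := by
  simp only [signedFeature, PiLp.inner_apply, ip, zmap, mul_sum, RCLike.inner_apply,
    conj_trivial]
  exact sum_congr rfl fun i _ => by ring

lemma abs_sgn (b : Bool) : |sgn b| = 1 := by cases b <;> simp [sgn]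

lemma norm_signedFeature_le {κ : Fin p → ℝ} (hK : ∀ i x x', |K i x x'| ≤ κ i ^ 2)
    (w : (X × Bool) × (X × Bool)) : ‖signedFeature K w‖ ≤ l2norm fun i => κ i ^ 2 := by
  rw [signedFeature, norm_toLp_eq_l2norm]
  refine Real.sqrt_le_sqrt (sum_le_sum fun i _ => sq_le_sq' ?_ ?_)
  all_goals
    have h : |sgn w.1.2 * sgn w.2.2 * K i w.1.1 w.2.1| ≤ κ i ^ 2 := by
      simpa [abs_mul, abs_sgn] using hK i w.1.1 w.2.1
  · exact (abs_le.1 h).1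
  · exact (abs_le.1 h).2

lemma measurable_signedFeature [MeasurableSpace X]
    (hK : ∀ i, Measurable fun w : X × X => K i w.1 w.2) : Measurable (signedFeature K) := by
  refine (MeasurableEquiv.toLp 2 (Fin p → ℝ)).measurable.comp (measurable_pi_lambda _ fun i => ?_)
  have hs : Measurable sgn := measurable_of_countable _
  have := (hK i).comp (g := fun w : X × X => K i w.1 w.2)
    (f := fun w : (X × Bool) × (X × Bool) => (w.1.1, w.2.1)) (by fun_prop)
  exact ((hs.comp (by fun_prop)).mul (hs.comp (by fun_prop))).mul this

/-- The hinge loss, shifted to vanish at zero margin. -/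
def shiftedHinge (u : ℝ) : ℝ := max (-1) (-u)

lemma shiftedHinge_zero : shiftedHinge 0 = 0 := by simp [shiftedHinge]

lemma abs_shiftedHinge_sub_le (a b : ℝ) : |shiftedHinge a - shiftedHinge b| ≤ |a - b| := by
  have := abs_max_sub_max_le_abs (-a) (-b) (-1)
  rw [max_comm _ (-1), max_comm _ (-1)] at this
  refine this.trans (le_of_eq ?_)
  rw [← abs_neg]
  congr 1
  ring

lemma hinge_eq (μ : Fin p → ℝ) (w w' : X × Bool) :
    hinge K μ w w' = 1 + shiftedHinge (inner ℝ (WithLp.toLp 2 μ) (signedFeature K (w, w'))) := by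
  rw [hinge, inner_signedFeature, shiftedHinge, ← max_add_add_left]
  ring_nf

lemma empRisk_eq (hn : 2 ≤ n) (μ : Fin p → ℝ) (S : Fin n → X × Bool) :
    empRisk K S μ = 1 + pairMean fun a b =>
      shiftedHinge (inner ℝ (WithLp.toLp 2 μ) (signedFeature K (S a, S b))) := by
  have : empRisk K S μ = pairMean fun a b => hinge K μ (S a) (S b) := rfl
  simp only [this, hinge_eq, pairMean_add, pairMean_const hn]

lemma empRisk_nonneg (hn : 2 ≤ n) (μ : Fin p → ℝ) (S : Fin n → X × Bool) : 0 ≤ empRisk K S μ :=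
  (pairMean_const hn 0).symm.trans_le (pairMean_mono hn fun _ _ => le_max_left _ _)

lemma empRisk_zero (hn : 2 ≤ n) (S : Fin n → X × Bool) : empRisk K S 0 = 1 := by
  simp [empRisk_eq K hn, shiftedHinge_zero, pairMean_const hn]

variable [MeasurableSpace X] {K} {κ : Fin p → ℝ}

lemma trueRisk_eq (hKm : ∀ i, Measurable fun w : X × X => K i w.1 w.2)
    (hK : ∀ i x x', |K i x x'| ≤ κ i ^ 2) (D : Measure (X × Bool)) [IsProbabilityMeasure D]
    (μ : Fin p → ℝ) :
    trueRisk K D μ = 1 + ∫ w, shiftedHinge (inner ℝ (WithLp.toLp 2 μ) (signedFeature K w))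
      ∂(D.prod D) := by
  have hi : Integrable (fun w => shiftedHinge (inner ℝ (WithLp.toLp 2 μ) (signedFeature K w)))
      (D.prod D) :=
    Integrable.of_bound ((continuous_of_abs_sub_le abs_shiftedHinge_sub_le).measurable.comp
      (measurable_signedFeature K hKm).const_inner).aestronglyMeasurable _
      (ae_of_all _ fun w => abs_comp_inner_le abs_shiftedHinge_sub_le shiftedHinge_zero le_rfl
        (norm_signedFeature_le K hK w))
  simp only [trueRisk, hinge_eq]
  rw [integral_add (integrable_const _) hi]
  simp

variable {m : ℕ} {s r η : ℝ}

lemma measure_exists_lt_trueRisk_sub_empRisk_le (hn : 2 ≤ n) (e : Fin m ⊕ Fin m ≃ Fin n)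
    (hKm : ∀ i, Measurable fun w : X × X => K i w.1 w.2)
    (hK : ∀ i x x', |K i x x'| ≤ κ i ^ 2) (D : Measure (X × Bool)) [IsProbabilityMeasure D]
    (hs : 0 ≤ s) (hr : 0 ≤ r) :
    (Measure.pi fun _ : Fin n => D)
      {S | ∃ μ : Fin p → ℝ, l2norm μ ≤ r ∧ η < trueRisk K D μ - empRisk K S μ} ≤
      ENNReal.ofReal (2 * Real.exp
        (m * (2 * s * r * l2norm fun i => κ i ^ 2) ^ 2 / 2 - m * s * η)) := by
  refine (measure_mono ?_).trans (measure_exists_pairMean_lt_le hn e D hs hr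
    abs_shiftedHinge_sub_le shiftedHinge_zero (measurable_signedFeature K hKm)
    (norm_signedFeature_le K hK))
  rintro S ⟨μ, hμ, h⟩
  refine ⟨WithLp.toLp 2 μ, (norm_toLp_eq_l2norm μ).trans_le hμ, ?_⟩
  rwa [trueRisk_eq hKm hK, empRisk_eq K hn, add_sub_add_left_eq_sub] at h

lemma measure_exists_lt_empRisk_sub_trueRisk_le (hn : 2 ≤ n) (e : Fin m ⊕ Fin m ≃ Fin n)
    (hKm : ∀ i, Measurable fun w : X × X => K i w.1 w.2)
    (hK : ∀ i x x', |K i x x'| ≤ κ i ^ 2) (D : Measure (X × Bool)) [IsProbabilityMeasure D]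
    (hs : 0 ≤ s) (hr : 0 ≤ r) :
    (Measure.pi fun _ : Fin n => D)
      {S | ∃ μ : Fin p → ℝ, l2norm μ ≤ r ∧ η < empRisk K S μ - trueRisk K D μ} ≤
      ENNReal.ofReal (2 * Real.exp
        (m * (2 * s * r * l2norm fun i => κ i ^ 2) ^ 2 / 2 - m * s * η)) := by
  refine (measure_mono ?_).trans (measure_exists_pairMean_lt_le (φ := fun u => -shiftedHinge u)
    hn e D hs hr (fun a b => ?_) (by simp [shiftedHinge_zero]) (measurable_signedFeature K hKm)
    (norm_signedFeature_le K hK))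
  · rintro S ⟨μ, hμ, h⟩
    refine ⟨WithLp.toLp 2 μ, (norm_toLp_eq_l2norm μ).trans_le hμ, ?_⟩
    rw [trueRisk_eq hKm hK, empRisk_eq K hn, add_sub_add_left_eq_sub] at h
    have := pairMean_const_mul (-1) fun a b =>
      shiftedHinge (inner ℝ (WithLp.toLp 2 μ) (signedFeature K (S a, S b)))
    simp only [neg_one_mul] at this
    rw [integral_neg, this]
    linarith
  · rw [neg_sub_neg, abs_sub_comm]
    exact abs_shiftedHinge_sub_le a b

/-- Regularization confines the minimizer to a ball, on which small deviations of the empirical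
risk transfer the guarantee of the oracle `μo`. -/
lemma trueRisk_le_of_isMin (hn : 2 ≤ n) {D : Measure (X × Bool)} {S : Fin n → X × Bool}
    {μo muh : Fin p → ℝ} {εo ε₁ : ℝ} (hε : 0 < ε₁) (hε' : ε₁ ≤ 3) (hμo : ∀ i, 0 ≤ μo i)
    (hM : 0 < l2norm μo) (hR : trueRisk K D μo ≤ εo)
    (h₁ : ∀ μ : Fin p → ℝ, l2norm μ ≤ √(3 / ε₁) * l2norm μo →
      trueRisk K D μ - empRisk K S μ ≤ ε₁ / 3)
    (h₂ : ∀ μ : Fin p → ℝ, l2norm μ ≤ √(3 / ε₁) * l2norm μo →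
      empRisk K S μ - trueRisk K D μ ≤ ε₁ / 3)
    (hmin : ∀ μ : Fin p → ℝ, (∀ i, 0 ≤ μ i) →
      (2 * ε₁ / (3 * l2norm μo ^ 2)) / 2 * l2norm muh ^ 2 + empRisk K S muh ≤
        (2 * ε₁ / (3 * l2norm μo ^ 2)) / 2 * l2norm μ ^ 2 + empRisk K S μ) :
    trueRisk K D muh ≤ εo + ε₁ := by
  have hr : (√(3 / ε₁) * l2norm μo) ^ 2 = 3 / ε₁ * l2norm μo ^ 2 := by
    rw [mul_pow, Real.sq_sqrt (by positivity)]
  have hmuh : l2norm muh ≤ √(3 / ε₁) * l2norm μo := by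
    refine le_of_sq_le_sq ?_ (by positivity)
    have h := hmin 0 fun _ => le_rfl
    have h0 : l2norm (0 : Fin p → ℝ) = 0 := by simp [l2norm]
    rw [empRisk_zero K hn, h0] at h
    have h1 := empRisk_nonneg K hn muh S
    have h2 : 2 * ε₁ / (3 * l2norm μo ^ 2) / 2 * l2norm muh ^ 2 ≤ 1 := by
      simp only [ne_eq, OfNat.ofNat_ne_zero, not_false_eq_true, zero_pow, mul_zero] at h
      linarith
    rw [hr]
    field_simp at h2 ⊢
    linarith
  have hμor : l2norm μo ≤ √(3 / ε₁) * l2norm μo :=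
    le_mul_of_one_le_left hM.le (Real.one_le_sqrt.2 ((one_le_div hε).2 hε'))
  have h1 := h₁ muh hmuh
  have h2 := h₂ μo hμor
  have h3 := hmin μo hμo
  have h4 : 2 * ε₁ / (3 * l2norm μo ^ 2) / 2 * l2norm μo ^ 2 = ε₁ / 3 := by
    field_simp
  have h5 : 0 ≤ 2 * ε₁ / (3 * l2norm μo ^ 2) / 2 * l2norm muh ^ 2 := by positivity
  linarith

end Risk

lemma l2norm_pos {p : ℕ} {μ : Fin p → ℝ} {i : Fin p} (hi : μ i ≠ 0) : 0 < l2norm μ :=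
  Real.sqrt_pos.2 (sum_pos' (fun _ _ => sq_nonneg _) ⟨i, mem_univ i, by positivity⟩)

lemma two_mul_exp_deviation_le {m M B ε δ : ℝ} (hM : 0 < M) (hB : 0 < B) (hε : 0 < ε)
    (hδ : 0 < δ) (hδ' : δ ≤ 1 / Real.exp 1)
    (hm : 864 * M ^ 2 * B ^ 2 * Real.log (1 / δ) / ε ^ 3 ≤ 2 * m) :
    2 * Real.exp (m * (2 * (ε ^ 2 / (36 * M ^ 2 * B ^ 2)) * (√(3 / ε) * M) * B) ^ 2 / 2 -
      m * (ε ^ 2 / (36 * M ^ 2 * B ^ 2)) * (ε / 3)) ≤ δ := by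
  have hL : 1 ≤ Real.log (1 / δ) := by
    rw [Real.le_log_iff_exp_le (by positivity)]
    exact (le_one_div hδ (Real.exp_pos 1)).1 hδ'
  have hr : √(3 / ε) ^ 2 = 3 / ε := Real.sq_sqrt (by positivity)
  have hexp : m * (2 * (ε ^ 2 / (36 * M ^ 2 * B ^ 2)) * (√(3 / ε) * M) * B) ^ 2 / 2 -
      m * (ε ^ 2 / (36 * M ^ 2 * B ^ 2)) * (ε / 3) = -(m * ε ^ 3 / (216 * M ^ 2 * B ^ 2)) := by
    simp only [mul_pow, hr]
    field_simp
    ring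
  have h2L : 2 * Real.log (1 / δ) ≤ m * ε ^ 3 / (216 * M ^ 2 * B ^ 2) := by
    rw [div_le_iff₀ (by positivity)] at hm
    rw [le_div_iff₀ (by positivity)]
    linarith
  have h2 : (2 : ℝ) ≤ Real.exp (Real.log (1 / δ)) := by
    have := Real.add_one_le_exp (Real.log (1 / δ))
    linarith
  calc _ ≤ Real.exp (Real.log (1 / δ)) * Real.exp (-(2 * Real.log (1 / δ))) := by
        rw [hexp]
        gcongr
    _ = δ := by
        rw [← Real.exp_add, one_div, Real.log_inv,
          show -Real.log δ + -(2 * -Real.log δ) = Real.log δ by ring, Real.exp_log hδ]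

/-- oracle inequality for L2-regularized two-stage MKL: with a suitable
universal constant C, sample size n ≥ C‖μ_o‖₂²‖κ‖₂²log(1/δ)/ε₁³ and λ = 2ε₁/(3‖μ_o‖₂²),
the regularized ERM is (ε_o + ε₁)-combination good with probability ≥ 1 − 2δ. -/
theorem stmt12 :
    ∃ C : ℝ, 0 < C ∧
      ∀ (X : Type) [MeasurableSpace X] (p : ℕ) (K : Fin p → X → X → ℝ),
        (∀ i, Measurable (fun w : X × X => K i w.1 w.2)) →
        ∀ (κ : Fin p → ℝ), (∀ i, 0 < κ i) → (∀ i x x', |K i x x'| ≤ κ i ^ 2) →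
        ∀ (D : Measure (X × Bool)), IsProbabilityMeasure D →
        ∀ (μo : Fin p → ℝ) (εo : ℝ), (∀ i, 0 ≤ μo i) → μo ≠ 0 →
          trueRisk K D μo ≤ εo →
        ∀ (ε₁ δ : ℝ), 0 < ε₁ → ε₁ < 3 / 4 → 0 < δ → δ ≤ 1 / Real.exp 1 →
        ∀ (n : ℕ), Even n →
          C * l2norm μo ^ 2 * l2norm (fun i => κ i ^ 2) ^ 2 * Real.log (1 / δ) / ε₁ ^ 3
            ≤ (n : ℝ) →
          ENNReal.ofReal (1 - 2 * δ) ≤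
            (Measure.pi fun _ : Fin n => D) {S | ∀ muh : Fin p → ℝ, (∀ i, 0 ≤ muh i) →
              (∀ μ : Fin p → ℝ, (∀ i, 0 ≤ μ i) →
                (2 * ε₁ / (3 * l2norm μo ^ 2)) / 2 * l2norm muh ^ 2 + empRisk K S muh ≤
                  (2 * ε₁ / (3 * l2norm μo ^ 2)) / 2 * l2norm μ ^ 2 + empRisk K S μ) →
              trueRisk K D muh ≤ εo + ε₁} := by
  refine ⟨864, by norm_num, ?_⟩
  intro X _ p K hKm κ hκ hK D hD μo εo hμo hμo0 hR ε₁ δ hε hε' hδ hδ' n hneven hn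
  obtain ⟨i, hi⟩ := Function.ne_iff.1 hμo0
  have hM : 0 < l2norm μo := l2norm_pos hi
  have hB : 0 < l2norm fun i => κ i ^ 2 := l2norm_pos (i := i) (pow_pos (hκ i) 2).ne'
  obtain ⟨m, rfl⟩ := hneven
  have hL : 0 < Real.log (1 / δ) := by
    refine Real.log_pos ?_
    have h1 := (le_one_div hδ (Real.exp_pos 1)).1 hδ'
    have h2 := Real.add_one_lt_exp one_ne_zero
    linarith
  have hn2 : 2 ≤ m + m := by
    have : (0 : ℝ) < (m + m : ℕ) := lt_of_lt_of_le (by positivity) hn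
    have : 0 < m + m := by exact_mod_cast this
    omega
  set r := √(3 / ε₁) * l2norm μo with hr
  set s := ε₁ ^ 2 / (36 * l2norm μo ^ 2 * l2norm (fun i => κ i ^ 2) ^ 2) with hs
  have hbound := two_mul_exp_deviation_le (m := m) hM hB hε hδ hδ' (by
    push_cast at hn
    linarith)
  rw [← hr, ← hs] at hbound
  have hs0 : 0 ≤ s := by positivity
  have hr0 : 0 ≤ r := by positivity
  set P := Measure.pi fun _ : Fin (m + m) => D
  set A₁ := {S : Fin (m + m) → X × Bool | ∃ μ : Fin p → ℝ, l2norm μ ≤ r ∧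
    ε₁ / 3 < trueRisk K D μ - empRisk K S μ}
  set A₂ := {S : Fin (m + m) → X × Bool | ∃ μ : Fin p → ℝ, l2norm μ ≤ r ∧
    ε₁ / 3 < empRisk K S μ - trueRisk K D μ}
  have hA₁ : P A₁ ≤ ENNReal.ofReal δ :=
    (measure_exists_lt_trueRisk_sub_empRisk_le hn2 finSumFinEquiv hKm hK D hs0 hr0).trans
      (ENNReal.ofReal_le_ofReal hbound)
  have hA₂ : P A₂ ≤ ENNReal.ofReal δ :=
    (measure_exists_lt_empRisk_sub_trueRisk_le hn2 finSumFinEquiv hKm hK D hs0 hr0).trans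
      (ENNReal.ofReal_le_ofReal hbound)
  have hA : P (A₁ ∪ A₂) ≤ ENNReal.ofReal (2 * δ) := by
    rw [two_mul, ENNReal.ofReal_add hδ.le hδ.le]
    exact (measure_union_le _ _).trans (add_le_add hA₁ hA₂)
  have hcompl : 1 ≤ P (A₁ ∪ A₂) + P (A₁ ∪ A₂)ᶜ := by
    rw [← measure_univ (μ := P), ← Set.union_compl_self (A₁ ∪ A₂)]
    exact measure_union_le _ _
  rw [ENNReal.ofReal_sub _ (by positivity), ENNReal.ofReal_one, tsub_le_iff_left]
  refine hcompl.trans (add_le_add hA (measure_mono ?_))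
  intro S hS muh _ hmin
  simp only [A₁, A₂, Set.mem_compl_iff, Set.mem_union, Set.mem_ofPred_eq, not_or, not_exists,
    not_and, not_lt] at hS
  exact trueRisk_le_of_isMin hn2 hε (by linarith) hμo hM hR hS.1 hS.2 hmin
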